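/- Let α = λ + kδ ∈ Λ, where λ is a primitive element of L and k ∈ ℤ. Then there exists an isometry g ∈ Γ such that g(α) belongs to L. -/

import Mathlib

noncomputable section

open LinearMap (BilinForm)

variable {V : Type*} [AddCommGroup V] [Module ℚ V]

/-- The group `O(B)` of isometries of a bilinear form `B`. -/
def isomGroup (B : BilinForm ℚ V) : Subgroup (V ≃ₗ[ℚ] V) where
  carrier := {g | ∀ x y, B (g x) (g y) = B x y}
  one_mem' := fun _ _ => rfl
  mul_mem' := by
    intro a b ha hb x y
    calc B ((a * b) x) ((a * b) y) = B (a (b x)) (a (b y)) := rfl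
      _ = B (b x) (b y) := ha _ _
      _ = B x y := hb _ _
  inv_mem' := by
    intro a ha x y
    calc B (a⁻¹ x) (a⁻¹ y) = B (a (a⁻¹ x)) (a (a⁻¹ y)) := (ha _ _).symm
      _ = B x y := by
          show B (a (a.symm x)) (a (a.symm y)) = B x y
          rw [a.apply_symm_apply, a.apply_symm_apply]

/-- `P` is a 3-dimensional positive-definite subspace for `B`. -/
def IsPosDefThree (B : BilinForm ℚ V) (P : Submodule ℚ V) : Prop :=
  Module.finrank ℚ P = 3 ∧ ∀ x ∈ P, x ≠ 0 → 0 < B x x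

/-- `g` preserves the orientation of the positive cone of `B`: for some 3-dimensional
positive-definite subspace `P`, the composition of the restriction of `g` to `P` with the
`B`-orthogonal projection back onto `P` has positive determinant. -/
def OrientPos (B : BilinForm ℚ V) (g : V ≃ₗ[ℚ] V) : Prop :=
  ∃ P : Submodule ℚ V, IsPosDefThree B P ∧
    ∃ π : V →ₗ[ℚ] V, (∀ x, π x ∈ P) ∧ (∀ x, ∀ p ∈ P, B (x - π x) p = 0) ∧
      ∃ q : ↥P →ₗ[ℚ] ↥P, (∀ x : ↥P, (q x : V) = π (g (x : V))) ∧ 0 < LinearMap.det q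

/-- The dual lattice `L* = {x : (x, L) ⊆ ℤ}` of a lattice `L`. -/
def dualLattice (B : BilinForm ℚ V) (L : Submodule ℤ V) : Submodule ℤ V where
  carrier := {x | ∀ y ∈ L, ∃ n : ℤ, B x y = (n : ℚ)}
  zero_mem' := by
    intro y _
    exact ⟨0, by simp⟩
  add_mem' := by
    intro a b ha hb y hy
    obtain ⟨m, hm⟩ := ha y hy
    obtain ⟨n, hn⟩ := hb y hy
    refine ⟨m + n, ?_⟩
    rw [map_add, LinearMap.add_apply, hm, hn]
    push_cast
    ring
  smul_mem' := by
    intro c x hx y hy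
    obtain ⟨n, hn⟩ := hx y hy
    refine ⟨c * n, ?_⟩
    have h1 : ((c : ℚ)) • x = c • x := Int.cast_smul_eq_zsmul ℚ c x
    rw [← h1, map_smul, LinearMap.smul_apply, hn, smul_eq_mul]
    push_cast
    ring

/-- `g` maps the lattice `L` bijectively onto itself. -/
def PreservesLattice (L : Submodule ℤ V) (g : V ≃ₗ[ℚ] V) : Prop :=
  (∀ x ∈ L, g x ∈ L) ∧ ∀ x ∈ L, g.symm x ∈ L

/-- `g` acts on the discriminant group `L*/L` as `+1` or as `-1`. -/
def ActsAsPMOne (B : BilinForm ℚ V) (L : Submodule ℤ V) (g : V ≃ₗ[ℚ] V) : Prop :=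
  (∀ x ∈ dualLattice B L, g x - x ∈ L) ∨ ∀ x ∈ dualLattice B L, g x + x ∈ L

/-- Membership in the subgroup `Γ ⊆ O⁺(Λ)` of isometries preserving the lattice and acting
on the discriminant group as `±1`. -/
def InGamma (B : BilinForm ℚ V) (L : Submodule ℤ V) (g : V ≃ₗ[ℚ] V) : Prop :=
  g ∈ isomGroup B ∧ PreservesLattice L g ∧ OrientPos B g ∧ ActsAsPMOne B L g

/-- The bilinear form of `Λ_ℚ = L_ℚ ⊕ ℚδ` with `(δ, δ) = -2d`. -/
def prodForm (B : BilinForm ℚ V) (d : ℤ) : BilinForm ℚ (V × ℚ) :=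
  LinearMap.mk₂ ℚ (fun p q => B p.1 q.1 - (2 * (d : ℚ)) * (p.2 * q.2))
    (fun p p' q => by
      simp only [Prod.fst_add, Prod.snd_add, map_add, LinearMap.add_apply]
      ring)
    (fun c p q => by
      simp only [Prod.smul_fst, Prod.smul_snd, map_smul, LinearMap.smul_apply, smul_eq_mul]
      ring)
    (fun p q q' => by
      simp only [Prod.fst_add, Prod.snd_add, map_add, LinearMap.add_apply]
      ring)
    (fun p c q => by
      simp only [Prod.smul_fst, Prod.smul_snd, map_smul, LinearMap.smul_apply, smul_eq_mul]
      ring)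

/-- The lattice `ℤ ⊆ ℚ`, i.e. the ℤ-span of `1`. -/
def intLat : Submodule ℤ ℚ := Submodule.span ℤ {(1 : ℚ)}

/-- Membership in the subgroup `O(L_ℚ) ⊆ O(Λ_ℚ)`: isometries of `Λ_ℚ = L_ℚ ⊕ ℚδ` preserving
`L_ℚ` and fixing `δ`, i.e. extensions of isometries of `L_ℚ` by the identity on `δ`. -/
def InOLQ (B : BilinForm ℚ V) (d : ℤ) (g : (V × ℚ) ≃ₗ[ℚ] (V × ℚ)) : Prop :=
  g ∈ isomGroup (prodForm B d) ∧ (∀ x : V, (g (x, 0)).2 = 0) ∧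
    g ((0 : V), (1 : ℚ)) = ((0 : V), (1 : ℚ))

/-- `B` has signature `(3, s)`: an orthogonal direct sum decomposition into a positive-definite
subspace of dimension `3` and a negative-definite subspace of dimension `s`. -/
def HasSignatureThree (B : BilinForm ℚ V) (s : ℕ) : Prop :=
  ∃ P N : Submodule ℚ V, IsCompl P N ∧ (∀ x ∈ P, ∀ y ∈ N, B x y = 0) ∧
    Module.finrank ℚ P = 3 ∧ Module.finrank ℚ N = s ∧
    (∀ x ∈ P, x ≠ 0 → 0 < B x x) ∧ ∀ x ∈ N, x ≠ 0 → B x x < 0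

/-- `L` contains a sublattice isometric to `U ⊕ U ⊕ U`, where `U` is the hyperbolic plane with
isotropic basis `e, f` and `(e, f) = -1`. -/
def ContainsU3 (B : BilinForm ℚ V) (L : Submodule ℤ V) : Prop :=
  ∃ e f : Fin 3 → V, (∀ i, e i ∈ L) ∧ (∀ i, f i ∈ L) ∧
    (∀ i j, B (e i) (e j) = 0) ∧ (∀ i j, B (f i) (f j) = 0) ∧
    ∀ i j, B (e i) (f j) = if i = j then -1 else 0

/-- `l` is a primitive element of the lattice `L`: `l ∈ L`, `l ≠ 0` and `L/ℤl` is
torsion-free. -/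
def IsPrimitiveIn (L : Submodule ℤ V) (l : V) : Prop :=
  l ∈ L ∧ l ≠ 0 ∧ ∀ y ∈ L, ∀ n : ℤ, n ≠ 0 →
    n • y ∈ Submodule.span ℤ ({l} : Set V) → y ∈ Submodule.span ℤ ({l} : Set V)

/-- The reflection `ρ_u(x) = x - (2(u,x)/(u,u))·u` (as a plain function). -/
def reflFun (B : BilinForm ℚ V) (u : V) (x : V) : V :=
  x - (2 * B u x / B u u) • u

/-- `(e₁, f₁)` and `(e₂, f₂)` are mutually orthogonal hyperbolic pairs in `L`. -/
structure IsHyperbolicFrame (B : BilinForm ℚ V) (L : Submodule ℤ V) (e₁ f₁ e₂ f₂ : V) :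
    Prop where
  mem_e₁ : e₁ ∈ L
  mem_f₁ : f₁ ∈ L
  mem_e₂ : e₂ ∈ L
  mem_f₂ : f₂ ∈ L
  e₁_e₁ : B e₁ e₁ = 0
  f₁_f₁ : B f₁ f₁ = 0
  e₂_e₂ : B e₂ e₂ = 0
  f₂_f₂ : B f₂ f₂ = 0
  e₁_f₁ : B e₁ f₁ = -1
  e₂_f₂ : B e₂ f₂ = -1
  e₁_e₂ : B e₁ e₂ = 0
  e₁_f₂ : B e₁ f₂ = 0
  f₁_e₂ : B f₁ e₂ = 0
  f₁_f₂ : B f₁ f₂ = 0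

namespace IsHyperbolicFrame

variable {B : BilinForm ℚ V} {L : Submodule ℤ V} {e₁ f₁ e₂ f₂ : V}

/-- Exchange the two hyperbolic pairs. -/
theorem exchange (hB : ∀ x y, B x y = B y x) (h : IsHyperbolicFrame B L e₁ f₁ e₂ f₂) :
    IsHyperbolicFrame B L e₂ f₂ e₁ f₁ where
  mem_e₁ := h.mem_e₂
  mem_f₁ := h.mem_f₂
  mem_e₂ := h.mem_e₁
  mem_f₂ := h.mem_f₁
  e₁_e₁ := h.e₂_e₂
  f₁_f₁ := h.f₂_f₂
  e₂_e₂ := h.e₁_e₁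
  f₂_f₂ := h.f₁_f₁
  e₁_f₁ := h.e₂_f₂
  e₂_f₂ := h.e₁_f₁
  e₁_e₂ := by rw [hB, h.e₁_e₂]
  e₁_f₂ := by rw [hB, h.f₁_e₂]
  f₁_e₂ := by rw [hB, h.e₁_f₂]
  f₁_f₂ := by rw [hB, h.f₁_f₂]

/-- Exchange the two vectors of the second hyperbolic pair. -/
theorem flip (hB : ∀ x y, B x y = B y x) (h : IsHyperbolicFrame B L e₁ f₁ e₂ f₂) :
    IsHyperbolicFrame B L e₁ f₁ f₂ e₂ where
  mem_e₁ := h.mem_e₁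
  mem_f₁ := h.mem_f₁
  mem_e₂ := h.mem_f₂
  mem_f₂ := h.mem_e₂
  e₁_e₁ := h.e₁_e₁
  f₁_f₁ := h.f₁_f₁
  e₂_e₂ := h.f₂_f₂
  f₂_f₂ := h.e₂_e₂
  e₁_f₁ := h.e₁_f₁
  e₂_f₂ := by rw [hB, h.e₂_f₂]
  e₁_e₂ := h.e₁_f₂
  e₁_f₂ := h.e₁_e₂
  f₁_e₂ := h.f₁_f₂
  f₁_f₂ := h.f₁_e₂

/-- Subtract a multiple of `f₁` from `f₂`, correcting `e₁` accordingly. -/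
theorem shear (hB : ∀ x y, B x y = B y x) (h : IsHyperbolicFrame B L e₁ f₁ e₂ f₂) (t : ℤ) :
    IsHyperbolicFrame B L (e₁ + t • e₂) f₁ e₂ (f₂ - t • f₁) where
  mem_e₁ := L.add_mem h.mem_e₁ (L.smul_mem _ h.mem_e₂)
  mem_f₁ := h.mem_f₁
  mem_e₂ := h.mem_e₂
  mem_f₂ := L.sub_mem h.mem_f₂ (L.smul_mem _ h.mem_f₁)
  e₁_e₁ := by simp [h.e₁_e₁, h.e₁_e₂, h.e₂_e₂, hB e₂ e₁]
  f₁_f₁ := h.f₁_f₁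
  e₂_e₂ := h.e₂_e₂
  f₂_f₂ := by simp [h.f₁_f₁, h.f₁_f₂, h.f₂_f₂, hB f₂ f₁]
  e₁_f₁ := by simp [h.e₁_f₁, h.f₁_e₂, hB e₂ f₁]
  e₂_f₂ := by simp [h.e₂_f₂, h.f₁_e₂, hB e₂ f₁]
  e₁_e₂ := by simp [h.e₁_e₂, h.e₂_e₂]
  e₁_f₂ := by simp [h.e₁_f₂, h.e₂_f₂, h.e₁_f₁, h.f₁_e₂, hB e₂ f₁]
  f₁_e₂ := h.f₁_e₂
  f₁_f₂ := by simp [h.f₁_f₂, h.f₁_f₁]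

/-- Euclidean descent: some hyperbolic pair is orthogonal to `l`, provided `(f₁, l) ≠ 0`. -/
theorem exists_orthogonal_pair_of_ne_zero (hB : ∀ x y, B x y = B y x)
    (hint : ∀ x ∈ L, ∀ y ∈ L, ∃ n : ℤ, B x y = (n : ℚ)) {l : V} (hl : l ∈ L) (m : ℤ)
    (h : IsHyperbolicFrame B L e₁ f₁ e₂ f₂) (hm : B f₁ l = m) (hm0 : m ≠ 0) :
    ∃ e ∈ L, ∃ f ∈ L, B e e = 0 ∧ B f f = 0 ∧ B e f = -1 ∧ B e l = 0 ∧ B f l = 0 := by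
  induction hn : m.natAbs using Nat.strong_induction_on generalizing m e₁ f₁ e₂ f₂ with
  | _ n ih =>
    have reduce : ∀ {a b c : V}, IsHyperbolicFrame B L a f₁ b c →
        (∃ t : ℤ, B (c - t • f₁) l = 0) ∨
          ∃ e ∈ L, ∃ f ∈ L, B e e = 0 ∧ B f f = 0 ∧ B e f = -1 ∧ B e l = 0 ∧ B f l = 0 := by
      intro a b c hf
      obtain ⟨v, hv⟩ := hint c hf.mem_f₂ l hl
      have hval : B (c - (v / m) • f₁) l = ((v % m : ℤ) : ℚ) := by
        rw [Int.emod_def]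
        simp [hv, hm, mul_comm]
      by_cases hr : v % m = 0
      · exact Or.inl ⟨v / m, by rw [hval, hr, Int.cast_zero]⟩
      · refine Or.inr (ih _ ?_ (v % m) ((hf.shear hB (v / m)).exchange hB) hval hr rfl)
        have h1 := Int.emod_nonneg v hm0
        have h2 := Int.emod_lt_abs v hm0
        rw [Int.abs_eq_natAbs] at h2
        omega
    obtain ⟨t, ht⟩ | hdone := reduce h
    · have h' := (h.shear hB t).flip hB
      obtain ⟨s, hs⟩ | hdone := reduce h'
      · have h'' := h'.shear hB s
        exact ⟨_, h''.mem_e₂, _, h''.mem_f₂, h''.e₂_e₂, h''.f₂_f₂, h''.e₂_f₂, ht, hs⟩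
      · exact hdone
    · exact hdone

/-- If `L` contains two orthogonal hyperbolic planes, then every `l ∈ L` is orthogonal to some
hyperbolic plane in `L`. -/
theorem exists_orthogonal_pair (hB : ∀ x y, B x y = B y x)
    (hint : ∀ x ∈ L, ∀ y ∈ L, ∃ n : ℤ, B x y = (n : ℚ)) {l : V} (hl : l ∈ L)
    (h : IsHyperbolicFrame B L e₁ f₁ e₂ f₂) :
    ∃ e ∈ L, ∃ f ∈ L, B e e = 0 ∧ B f f = 0 ∧ B e f = -1 ∧ B e l = 0 ∧ B f l = 0 := by
  have key : ∀ {a b c f : V}, IsHyperbolicFrame B L a f b c → B f l ≠ 0 →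
      ∃ e ∈ L, ∃ f ∈ L, B e e = 0 ∧ B f f = 0 ∧ B e f = -1 ∧ B e l = 0 ∧ B f l = 0 := by
    intro a b c f hf hne
    obtain ⟨m, hm⟩ := hint f hf.mem_f₁ l hl
    refine hf.exists_orthogonal_pair_of_ne_zero hB hint hl m hm ?_
    rintro rfl
    exact hne (by simpa using hm)
  by_cases he : B e₂ l = 0
  · by_cases hf : B f₂ l = 0
    · exact ⟨e₂, h.mem_e₂, f₂, h.mem_f₂, h.e₂_e₂, h.f₂_f₂, h.e₂_f₂, he, hf⟩
    · exact key (h.exchange hB) hf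
  · exact key ((h.flip hB).exchange hB) he

end IsHyperbolicFrame

/-- A primitive vector of a unimodular lattice pairs to `1` with some lattice vector. -/
theorem IsPrimitiveIn.exists_pairing_eq_one {B : BilinForm ℚ V} {L : Submodule ℤ V} {l : V}
    (hB : ∀ x y, B x y = B y x)
    (hint : ∀ x ∈ L, ∀ y ∈ L, ∃ n : ℤ, B x y = (n : ℚ))
    (hunimod : dualLattice B L = L) (h : IsPrimitiveIn L l) : ∃ y ∈ L, B y l = 1 := by
  obtain ⟨hl, hl0, hprim⟩ := h
  have isUnit_of_dvd : ∀ n : ℤ, n ≠ 0 → (∀ y ∈ L, ∃ m : ℤ, B y l = ((n * m : ℤ) : ℚ)) →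
      IsUnit n := by
    intro n hn hdvd
    have hn' : (n : ℚ) ≠ 0 := Int.cast_ne_zero.mpr hn
    have hsmul : n • ((n : ℚ)⁻¹ • l) = l := by
      rw [← Int.cast_smul_eq_zsmul ℚ, smul_smul, mul_inv_cancel₀ hn', one_smul]
    have hmem : (n : ℚ)⁻¹ • l ∈ L := by
      rw [← hunimod]
      intro y hy
      obtain ⟨m, hm⟩ := hdvd y hy
      refine ⟨m, ?_⟩
      rw [map_smul, LinearMap.smul_apply, hB l y, hm, smul_eq_mul]
      push_cast
      field_simp
    have hspan := hprim _ hmem n hn (by rw [hsmul]; exact Submodule.mem_span_singleton_self l)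
    obtain ⟨m, hm⟩ := Submodule.mem_span_singleton.mp hspan
    have hone : ((n * m : ℤ) : ℚ) • l = (1 : ℚ) • l := by
      rw [Int.cast_smul_eq_zsmul, mul_smul, hm, hsmul, one_smul]
    have hnm : ((n * m : ℤ) : ℚ) = 1 := smul_left_injective ℚ hl0 hone
    exact IsUnit.of_mul_eq_one m (by exact_mod_cast hnm)
  let I : Ideal ℤ :=
    { carrier := {n | ∃ y ∈ L, B y l = (n : ℚ)}
      zero_mem' := ⟨0, L.zero_mem, by simp⟩
      add_mem' := by
        rintro a b ⟨x, hx, hxa⟩ ⟨y, hy, hyb⟩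
        exact ⟨x + y, L.add_mem hx hy, by simp [hxa, hyb]⟩
      smul_mem' := by
        rintro c a ⟨x, hx, hxa⟩
        exact ⟨c • x, L.smul_mem c hx, by simp [hxa]⟩ }
  obtain ⟨g, hg⟩ := (IsPrincipalIdealRing.principal I).principal
  have hdvd : ∀ y ∈ L, ∃ m : ℤ, B y l = ((g * m : ℤ) : ℚ) := by
    intro y hy
    obtain ⟨n, hn⟩ := hint y hy l hl
    have hnI : n ∈ I := ⟨y, hy, hn⟩
    rw [hg] at hnI
    obtain ⟨m, rfl⟩ := Submodule.mem_span_singleton.mp hnI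
    exact ⟨m, by rw [hn, smul_eq_mul, mul_comm]⟩
  have hg0 : g ≠ 0 := by
    rintro rfl
    have h2 := isUnit_of_dvd 2 two_ne_zero fun y hy => by
      obtain ⟨m, hm⟩ := hdvd y hy
      exact ⟨0, by simpa using hm⟩
    rw [Int.isUnit_iff] at h2
    omega
  have htop : I = ⊤ := by
    rw [hg]
    exact Ideal.span_singleton_eq_top.mpr (isUnit_of_dvd g hg0 hdvd)
  obtain ⟨y, hy, hy1⟩ : (1 : ℤ) ∈ I := htop ▸ Submodule.mem_top
  exact ⟨y, hy, by simpa using hy1⟩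

/-- A primitive vector of an even unimodular lattice containing two orthogonal hyperbolic planes
pairs to `1` with some isotropic lattice vector. -/
theorem IsPrimitiveIn.exists_isotropic_pairing_eq_one {B : BilinForm ℚ V} {L : Submodule ℤ V}
    {l e₁ f₁ e₂ f₂ : V} (hB : ∀ x y, B x y = B y x)
    (hint : ∀ x ∈ L, ∀ y ∈ L, ∃ n : ℤ, B x y = (n : ℚ))
    (heven : ∀ x ∈ L, ∃ n : ℤ, B x x = 2 * (n : ℚ))
    (hunimod : dualLattice B L = L) (h : IsPrimitiveIn L l)
    (hF : IsHyperbolicFrame B L e₁ f₁ e₂ f₂) :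
    ∃ w ∈ L, B w w = 0 ∧ B w l = 1 := by
  obtain ⟨y, hy, hyl⟩ := h.exists_pairing_eq_one hB hint hunimod
  obtain ⟨e, he, f, hf, hee, hff, hef, hel, hfl⟩ := hF.exists_orthogonal_pair hB hint h.1
  obtain ⟨q, hq⟩ := heven y hy
  obtain ⟨a, ha⟩ := hint y hy e he
  obtain ⟨c, hc⟩ := hint y hy f hf
  refine ⟨y + (c + 1) • e + (a + q + a * c) • f,
    L.add_mem (L.add_mem hy (L.smul_mem _ he)) (L.smul_mem _ hf), ?_, ?_⟩
  · simp only [map_add, map_zsmul, LinearMap.add_apply, LinearMap.smul_apply, hB e y, hB f y,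
      hB f e, hq, ha, hc, hee, hff, hef, zsmul_eq_mul]
    push_cast
    ring
  · simp [hyl, hel, hfl]

/-- The Eichler transvection of `V ⊕ ℚδ` attached to an isotropic `w ∈ V` and `δ`, as a
linear map. -/
def eichlerMap (B : BilinForm ℚ V) (d : ℤ) (w : V) : (V × ℚ) →ₗ[ℚ] (V × ℚ) where
  toFun p := (p.1 + (2 * d * p.2 + d * B w p.1) • w, p.2 + B w p.1)
  map_add' p q := by
    ext
    · simp only [Prod.fst_add, Prod.snd_add, map_add]
      module
    · simp only [Prod.fst_add, Prod.snd_add, map_add]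
      ring
  map_smul' c p := by
    ext
    · simp only [Prod.smul_fst, Prod.smul_snd, map_smul, smul_eq_mul, RingHom.id_apply]
      module
    · simp only [Prod.smul_fst, Prod.smul_snd, map_smul, smul_eq_mul, RingHom.id_apply]
      ring

theorem eichlerMap_apply (B : BilinForm ℚ V) (d : ℤ) (w : V) (p : V × ℚ) :
    eichlerMap B d w p = (p.1 + (2 * d * p.2 + d * B w p.1) • w, p.2 + B w p.1) := rfl

theorem eichlerMap_neg_apply_eichlerMap {B : BilinForm ℚ V} (d : ℤ) {w : V} (hw : B w w = 0)
    (p : V × ℚ) : eichlerMap B d (-w) (eichlerMap B d w p) = p := by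
  ext
  · simp only [eichlerMap_apply, map_add, map_neg, map_smul, LinearMap.neg_apply, hw,
      smul_eq_mul]
    module
  · simp [eichlerMap_apply, hw]

/-- The Eichler transvection of `V ⊕ ℚδ` attached to an isotropic `w ∈ V` and `δ`. -/
def eichler {B : BilinForm ℚ V} (d : ℤ) {w : V} (hw : B w w = 0) : (V × ℚ) ≃ₗ[ℚ] (V × ℚ) :=
  LinearEquiv.ofLinearMap (eichlerMap B d w) (eichlerMap B d (-w))
    (LinearMap.ext fun p => by
      simpa using eichlerMap_neg_apply_eichlerMap (B := B) d (w := -w) (by simpa using hw) p)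
    (LinearMap.ext fun p => by simpa using eichlerMap_neg_apply_eichlerMap d hw p)

section eichler

variable {B : BilinForm ℚ V} {L : Submodule ℤ V} {d : ℤ} {w : V}

theorem eichler_apply (hw : B w w = 0) (p : V × ℚ) :
    eichler d hw p = (p.1 + (2 * d * p.2 + d * B w p.1) • w, p.2 + B w p.1) := rfl

theorem prodForm_apply (B : BilinForm ℚ V) (d : ℤ) (p q : V × ℚ) :
    prodForm B d p q = B p.1 q.1 - 2 * d * (p.2 * q.2) := rfl

theorem mem_intLat {r : ℚ} : r ∈ intLat ↔ ∃ n : ℤ, (n : ℚ) = r := by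
  simp [intLat, Submodule.mem_span_singleton]

theorem eichler_mem_isomGroup (hB : ∀ x y, B x y = B y x) (hw : B w w = 0) :
    eichler d hw ∈ isomGroup (prodForm B d) := by
  intro p q
  simp only [prodForm_apply, eichler_apply, map_add, map_smul, LinearMap.add_apply,
    LinearMap.smul_apply, smul_eq_mul, hw, hB p.1 w]
  ring

theorem eichlerMap_mem (hint : ∀ x ∈ L, ∀ y ∈ L, ∃ n : ℤ, B x y = (n : ℚ)) (hwL : w ∈ L)
    {p : V × ℚ} (hp : p ∈ L.prod intLat) : eichlerMap B d w p ∈ L.prod intLat := by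
  obtain ⟨hp1, hp2⟩ := Submodule.mem_prod.mp hp
  obtain ⟨m, hm⟩ := hint w hwL p.1 hp1
  obtain ⟨r, hr⟩ := mem_intLat.mp hp2
  refine Submodule.mem_prod.mpr ⟨L.add_mem hp1 ?_, mem_intLat.mpr ⟨r + m, ?_⟩⟩
  · have hc : 2 * (d : ℚ) * p.2 + d * B w p.1 = ((2 * d * r + d * m : ℤ) : ℚ) := by
      rw [hm, ← hr]
      push_cast
      ring
    rw [hc, Int.cast_smul_eq_zsmul]
    exact L.smul_mem _ hwL
  · rw [eichlerMap_apply, hm, ← hr, Int.cast_add]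

theorem eichler_preservesLattice (hint : ∀ x ∈ L, ∀ y ∈ L, ∃ n : ℤ, B x y = (n : ℚ))
    (hw : B w w = 0) (hwL : w ∈ L) : PreservesLattice (L.prod intLat) (eichler d hw) :=
  ⟨fun _ hp => eichlerMap_mem hint hwL hp, fun _ hp => eichlerMap_mem hint (L.neg_mem hwL) hp⟩

theorem eichler_actsAsPMOne (hB : ∀ x y, B x y = B y x) (hw : B w w = 0) (hwL : w ∈ L) :
    ActsAsPMOne (prodForm B d) (L.prod intLat) (eichler d hw) := by
  refine Or.inl fun p hp => ?_
  obtain ⟨m, hm⟩ := hp (w, 0) (Submodule.mem_prod.mpr ⟨hwL, intLat.zero_mem⟩)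
  obtain ⟨r, hr⟩ := hp (0, 1)
    (Submodule.mem_prod.mpr ⟨L.zero_mem, Submodule.mem_span_singleton_self 1⟩)
  simp only [prodForm_apply, map_zero, mul_zero, mul_one, sub_zero, zero_sub] at hm hr
  rw [hB] at hm
  refine Submodule.mem_prod.mpr ⟨?_, mem_intLat.mpr ⟨m, ?_⟩⟩
  · have hc : 2 * (d : ℚ) * p.2 + d * B w p.1 = ((-r + d * m : ℤ) : ℚ) := by
      rw [hm]
      push_cast
      linarith
    rw [eichler_apply, Prod.fst_sub, add_sub_cancel_left, hc, Int.cast_smul_eq_zsmul]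
    exact L.smul_mem _ hwL
  · rw [eichler_apply, Prod.snd_sub, add_sub_cancel_left, hm]

theorem eichler_orientPos (hd : 0 ≤ d) (hB : ∀ x y, B x y = B y x) {s : ℕ}
    (hsig : HasSignatureThree B s) (hw : B w w = 0) :
    OrientPos (prodForm B d) (eichler d hw) := by
  obtain ⟨P, N, hPN, horth, hP3, -, hpos, -⟩ := hsig
  have hfin : FiniteDimensional ℚ P := FiniteDimensional.of_finrank_pos (by omega)
  let p := P.projection N hPN
  have hpP : ∀ x, p x ∈ P := fun x => Submodule.projection_apply_mem hPN x
  have hpid : ∀ x ∈ P, p x = x := fun x hx => Submodule.projection_apply_of_mem_left hPN hx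
  have hsub : ∀ x, x - p x ∈ N := fun x => by
    rw [← Submodule.projection_apply_eq_zero_iff hPN, map_sub, sub_eq_zero]
    exact (hpid _ (hpP x)).symm
  have hperp : ∀ x, ∀ y ∈ P, B (x - p x) y = 0 := fun x y hy => by
    rw [hB, horth y hy _ (hsub x)]
  let Q : Submodule ℚ (V × ℚ) := P.map (LinearMap.inl ℚ V ℚ)
  have hinl : Function.Injective (LinearMap.inl ℚ V ℚ) := LinearMap.inl_injective
  have hQmem : ∀ x ∈ P, ((x, 0) : V × ℚ) ∈ Q := fun x hx => Submodule.mem_map_of_mem hx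
  have hQ : ∀ z ∈ Q, z.1 ∈ P ∧ z.2 = 0 := by
    rintro _ ⟨x, hx, rfl⟩
    exact ⟨hx, rfl⟩
  have hQfin : FiniteDimensional ℚ Q := inferInstance
  refine ⟨Q, ⟨?_, ?_⟩, LinearMap.inl ℚ V ℚ ∘ₗ p ∘ₗ LinearMap.fst ℚ V ℚ,
    fun x => hQmem _ (hpP _), ?_, ?_⟩
  · rw [← hP3]
    exact (Submodule.equivMapOfInjective _ hinl P).finrank_eq.symm
  · rintro _ ⟨x, hx, rfl⟩ hne
    have hx0 : x ≠ 0 := by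
      rintro rfl
      exact hne (map_zero _)
    simpa [prodForm_apply] using hpos x hx hx0
  · rintro x _ ⟨y, hy, rfl⟩
    simpa [prodForm_apply] using hperp x.1 y hy
  · let φ : Module.Dual ℚ Q := ((d : ℚ) • B w) ∘ₗ LinearMap.fst ℚ V ℚ ∘ₗ Q.subtype
    let v : Q := ⟨(p w, 0), hQmem _ (hpP w)⟩
    refine ⟨LinearMap.transvection φ v, ?_, ?_⟩
    · intro z
      obtain ⟨h1, h2⟩ := hQ z z.2
      ext
      · simp [LinearMap.transvection.apply, φ, v, eichler_apply, h2, hpid _ h1]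
      · simp [LinearMap.transvection.apply, v, h2]
    · rw [LinearMap.transvection.det]
      have hself : B w (p w) = B (p w) (p w) := by
        have := hperp w (p w) (hpP w)
        rwa [map_sub, LinearMap.sub_apply, sub_eq_zero] at this
      have hnonneg : 0 ≤ B (p w) (p w) := by
        by_cases h0 : p w = 0
        · simp [h0]
        · exact (hpos _ (hpP w) h0).le
      have hφ : φ v = d * B (p w) (p w) := by simp [φ, v, hself]
      have hd' : (0 : ℚ) ≤ d := by exact_mod_cast hd
      rw [hφ]
      positivity

end eichler

/-- Let `α = λ + kδ ∈ Λ`, with `λ` a primitive element of `L` and `k ∈ ℤ`.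
Then there exists `g ∈ Γ` such that `g(α)` belongs to `L`. -/
theorem statement1
    {V : Type*} [AddCommGroup V] [Module ℚ V] [FiniteDimensional ℚ V]
    (B : BilinForm ℚ V) (L : Submodule ℤ V) (d : ℤ)
    (hsymm : ∀ x y, B x y = B y x)
    (hfull : Submodule.span ℚ (L : Set V) = ⊤)
    (hfg : L.FG)
    (hint : ∀ x ∈ L, ∀ y ∈ L, ∃ n : ℤ, B x y = (n : ℚ))
    (heven : ∀ x ∈ L, ∃ n : ℤ, B x x = 2 * (n : ℚ))
    (hunimod : dualLattice B L = L)
    (sminus : ℕ) (hs : 3 ≤ sminus) (hsig : HasSignatureThree B sminus)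
    (hU3 : ContainsU3 B L)
    (hd : 0 < d)
    (lam : V) (hprim : IsPrimitiveIn L lam) (k : ℤ) :
    ∃ g : (V × ℚ) ≃ₗ[ℚ] (V × ℚ), InGamma (prodForm B d) (L.prod intLat) g ∧
      g ((lam, (k : ℚ))) ∈ L.prod (⊥ : Submodule ℤ ℚ) := by
  obtain ⟨e, f, he, hf, hee, hff, hef⟩ := hU3
  have hF : IsHyperbolicFrame B L (e 0) (f 0) (e 1) (f 1) :=
    { mem_e₁ := he 0, mem_f₁ := hf 0, mem_e₂ := he 1, mem_f₂ := hf 1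
      e₁_e₁ := hee 0 0, f₁_f₁ := hff 0 0, e₂_e₂ := hee 1 1, f₂_f₂ := hff 1 1
      e₁_f₁ := by simp [hef], e₂_f₂ := by simp [hef]
      e₁_e₂ := hee 0 1, e₁_f₂ := by simp [hef]
      f₁_e₂ := by simp [hsymm (f 0), hef], f₁_f₂ := hff 0 1 }
  obtain ⟨u, huL, huu, hul⟩ :=
    hprim.exists_isotropic_pairing_eq_one hsymm hint heven hunimod hF
  have hw : B (-k • u) (-k • u) = 0 := by simp [huu]
  have hwL : -k • u ∈ L := L.smul_mem _ huL
  have hwl : B (-k • u) lam = -k := by simp [hul]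
  have hgamma : InGamma (prodForm B d) (L.prod intLat) (eichler d hw) :=
    ⟨eichler_mem_isomGroup hsymm hw, eichler_preservesLattice hint hw hwL,
      eichler_orientPos hd.le hsymm hsig hw, eichler_actsAsPMOne hsymm hw hwL⟩
  have hmem : (lam, (k : ℚ)) ∈ L.prod intLat :=
    Submodule.mem_prod.mpr ⟨hprim.1, mem_intLat.mpr ⟨k, rfl⟩⟩
  refine ⟨eichler d hw, hgamma, Submodule.mem_prod.mpr ⟨?_, ?_⟩⟩
  · exact (Submodule.mem_prod.mp (hgamma.2.1.1 _ hmem)).1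
  · rw [Submodule.mem_bot, eichler_apply, hwl, add_neg_cancel]
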